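/- Let A be an M_K(ℂ)-valued trigonometric polynomial of bidegree at most (w, M). If for every separable complex Hilbert space F and every unitary representation π of the direct product group Z₂^{*g} × 𝔜 on F the operator A(π) is positive definite, then there exist positive integers K′ and M′ and an analytic polynomial B of bidegree at most (w, M′) with coefficients in the K′×K complex matrices such that A = B*B; that is, for every α ∈ Z₂^{*g} × 𝔜 the coefficient A_α (set equal to 0 when α ∉ Her W_{≤w} × Her 𝒴_{≤M}) equals the sum of B_β* B_γ over all pairs β, γ ∈ W_{≤w} × 𝒴_{≤M′} with β⁻¹γ = α. -/

import Mathlib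

open scoped ComplexInnerProductSpace
open Matrix

/-- The strict shortlex order on words over the alphabet `Fin n`:
first compare lengths, ties broken by the lexicographic order. -/
def ShortlexLT {n : ℕ} (a b : List (Fin n)) : Prop :=
  a.length < b.length ∨ (a.length = b.length ∧ List.Lex (· < ·) a b)

/-- The shortlex order on words over the alphabet `Fin n`. -/
def ShortlexLE {n : ℕ} (a b : List (Fin n)) : Prop :=
  ShortlexLT a b ∨ a = b

/-- The relations `x_i² = e` presenting the free product of `g` copies of `ℤ/2`. -/
def z2Rels (g : ℕ) : Set (FreeGroup (Fin g)) :=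
  {r | ∃ i : Fin g, r = FreeGroup.of i * FreeGroup.of i}

/-- The free product `ℤ₂^{*g}` of `g` copies of the cyclic group of order two. -/
abbrev Z2Star (g : ℕ) := PresentedGroup (z2Rels g)

/-- The canonical generators of `ℤ₂^{*g}`. -/
def z2of {g : ℕ} (i : Fin g) : Z2Star g := PresentedGroup.of (rels := z2Rels g) i

/-- The element of `ℤ₂^{*g}` given by a word in the generators. -/
def wordZ {g : ℕ} (l : List (Fin g)) : Z2Star g := (l.map z2of).prod

/-- The shortlex order on `ℤ₂^{*g}`, via reduced words (words with consecutive
letters distinct), compared in shortlex. -/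
def Z2ShortlexLE {g : ℕ} (a b : Z2Star g) : Prop :=
  ∃ la lb : List (Fin g), List.Chain' (· ≠ ·) la ∧ List.Chain' (· ≠ ·) lb ∧
    wordZ la = a ∧ wordZ lb = b ∧ ShortlexLE la lb

/-- `W_{≤ w}` in `ℤ₂^{*g}`. -/
def WleZ {g : ℕ} (w : Z2Star g) : Set (Z2Star g) := {v | Z2ShortlexLE v w}

/-- `Her W_{≤ w} = {u⁻¹ v : u, v ∈ W_{≤ w}}` in `ℤ₂^{*g}`. -/
def HerWleZ {g : ℕ} (w : Z2Star g) : Set (Z2Star g) :=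
  {α | ∃ u ∈ WleZ w, ∃ v ∈ WleZ w, u⁻¹ * v = α}

/-- `𝒴_{≤ M}`: products of at most `M` of the generators `y`. -/
def Yle {h : ℕ} {Y : Type*} [Group Y] (y : Fin h → Y) (M : ℕ) : Set Y :=
  {a | ∃ l : List (Fin h), l.length ≤ M ∧ (l.map y).prod = a}

/-- `Her 𝒴_{≤ M} = {a⁻¹ b : a, b ∈ 𝒴_{≤ M}}`. -/
def HerYle {h : ℕ} {Y : Type*} [Group Y] (y : Fin h → Y) (M : ℕ) : Set Y :=
  {η | ∃ a ∈ Yle y M, ∃ b ∈ Yle y M, a⁻¹ * b = η}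

theorem z2of_mul_self {g : ℕ} (i : Fin g) : z2of i * z2of i = 1 := by
  have h : FreeGroup.of i * FreeGroup.of i ∈ Subgroup.normalClosure (z2Rels g) :=
    Subgroup.subset_normalClosure ⟨i, rfl⟩
  exact (QuotientGroup.eq_one_iff _).2 h

theorem z2of_mul_cancel_left {g : ℕ} (i : Fin g) (v : Z2Star g) :
    z2of i * (z2of i * v) = v := by
  rw [← mul_assoc, z2of_mul_self, one_mul]

theorem z2of_inv {g : ℕ} (i : Fin g) : (z2of i)⁻¹ = z2of i :=
  inv_eq_of_mul_eq_one_left (z2of_mul_self i)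

theorem wordZ_cons {g : ℕ} (i : Fin g) (l : List (Fin g)) :
    wordZ (i :: l) = z2of i * wordZ l := by
  simp [wordZ]

/-- Left multiplication by a generator, on words without repeated consecutive letters. -/
def consCancel {g : ℕ} (i : Fin g) : List (Fin g) → List (Fin g)
  | [] => [i]
  | a :: l => if a = i then l else i :: a :: l

theorem isChain_consCancel {g : ℕ} (i : Fin g) {l : List (Fin g)} (hl : l.IsChain (· ≠ ·)) :
    (consCancel i l).IsChain (· ≠ ·) := by
  cases l with
  | nil => simp [consCancel]
  | cons a l =>
    by_cases h : a = i
    · simpa [consCancel, h] using hl.tail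
    · simpa [consCancel, h, Ne.symm h] using hl

theorem consCancel_consCancel {g : ℕ} (i : Fin g) {l : List (Fin g)}
    (hl : l.IsChain (· ≠ ·)) : consCancel i (consCancel i l) = l := by
  cases l with
  | nil => simp [consCancel]
  | cons a l =>
    by_cases h : a = i
    · subst h
      cases l with
      | nil => simp [consCancel]
      | cons b l =>
        have : b ≠ a := by
          have := hl
          simp only [List.isChain_cons_cons] at this
          exact this.1.symm
        simp [consCancel, this]
    · simp [consCancel, h]

theorem consCancel_of_isChain {g : ℕ} {i : Fin g} {l : List (Fin g)}
    (hl : (i :: l).IsChain (· ≠ ·)) : consCancel i l = i :: l := by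
  cases l with
  | nil => simp [consCancel]
  | cons a l =>
    simp only [List.isChain_cons_cons] at hl
    simp [consCancel, hl.1.symm]

theorem wordZ_consCancel {g : ℕ} (i : Fin g) (l : List (Fin g)) :
    wordZ (consCancel i l) = z2of i * wordZ l := by
  cases l with
  | nil => simp [consCancel, wordZ]
  | cons a l =>
    by_cases h : a = i
    · simp [consCancel, h, wordZ_cons, z2of_mul_cancel_left]
    · simp [consCancel, h, wordZ_cons]

/-- The permutation of the reduced words induced by a generator. -/
def consCancelPerm {g : ℕ} (i : Fin g) :
    Equiv.Perm {l : List (Fin g) // l.IsChain (· ≠ ·)} where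
  toFun l := ⟨consCancel i l.1, isChain_consCancel i l.2⟩
  invFun l := ⟨consCancel i l.1, isChain_consCancel i l.2⟩
  left_inv l := Subtype.ext (consCancel_consCancel i l.2)
  right_inv l := Subtype.ext (consCancel_consCancel i l.2)

/-- A homomorphism out of `ℤ₂^{*g}` given by involutions. -/
def z2Lift {g : ℕ} {G : Type*} [Group G] (f : Fin g → G) (hf : ∀ i, f i * f i = 1) :
    Z2Star g →* G :=
  PresentedGroup.toGroup (f := f) (by
    rintro r ⟨i, rfl⟩
    simpa using hf i)

theorem z2Lift_z2of {g : ℕ} {G : Type*} [Group G] (f : Fin g → G) (hf : ∀ i, f i * f i = 1)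
    (i : Fin g) : z2Lift f hf (z2of i) = f i :=
  PresentedGroup.toGroup.of _

/-- The action of `ℤ₂^{*g}` on reduced words. -/
def reducedAction (g : ℕ) : Z2Star g →* Equiv.Perm {l : List (Fin g) // l.IsChain (· ≠ ·)} :=
  z2Lift consCancelPerm fun i => by
    ext1 l
    exact Subtype.ext (consCancel_consCancel i l.2)

theorem reducedAction_wordZ {g : ℕ} (l : List (Fin g)) (hl : l.IsChain (· ≠ ·)) :
    (reducedAction g (wordZ l) ⟨[], List.isChain_nil⟩).1 = l := by
  induction l with
  | nil => simp [wordZ]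
  | cons a l ih =>
    rw [wordZ_cons, map_mul, Equiv.Perm.mul_apply, reducedAction, z2Lift_z2of]
    change consCancel a _ = _
    rw [show (z2Lift consCancelPerm _ (wordZ l) ⟨[], List.isChain_nil⟩).1 = l from ih hl.tail]
    exact consCancel_of_isChain hl

theorem wordZ_injOn {g : ℕ} {l l' : List (Fin g)} (hl : l.IsChain (· ≠ ·))
    (hl' : l'.IsChain (· ≠ ·)) (h : wordZ l = wordZ l') : l = l' := by
  rw [← reducedAction_wordZ l hl, ← reducedAction_wordZ l' hl', h]

theorem z2Star_induction {g : ℕ} {p : Z2Star g → Prop} (one : p 1)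
    (mul : ∀ i v, p v → p (z2of i * v)) (v : Z2Star g) : p v := by
  have key : ∀ u : FreeGroup (Fin g), ∀ v, p v → p (PresentedGroup.mk (z2Rels g) u * v) := by
    intro u
    induction u using FreeGroup.induction_on with
    | C1 => intro v hv; simpa using hv
    | of i => intro v hv; exact mul i v hv
    | inv_of i _ =>
      intro v hv
      rw [map_inv]
      change p ((z2of i)⁻¹ * v)
      rw [z2of_inv]
      exact mul i v hv
    | mul a b ha hb =>
      intro v hv
      rw [map_mul, mul_assoc]
      exact ha _ (hb _ hv)
  obtain ⟨u, rfl⟩ := PresentedGroup.mk_surjective _ v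
  simpa using key u 1 one

theorem exists_reduced {g : ℕ} (v : Z2Star g) :
    ∃ l : List (Fin g), l.IsChain (· ≠ ·) ∧ wordZ l = v := by
  induction v using z2Star_induction with
  | one => exact ⟨[], List.isChain_nil, by simp [wordZ]⟩
  | mul i v hv =>
    obtain ⟨l, hl, rfl⟩ := hv
    exact ⟨consCancel i l, isChain_consCancel i hl, wordZ_consCancel i l⟩

theorem shortlexLE_of_length_lt {n : ℕ} {a b : List (Fin n)} (h : a.length < b.length) :
    ShortlexLE a b := Or.inl (Or.inl h)

theorem ShortlexLE.length_le {n : ℕ} {a b : List (Fin n)} (h : ShortlexLE a b) :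
    a.length ≤ b.length := by
  rcases h with (h | h) | h
  · exact h.le
  · exact h.1.le
  · rw [h]

theorem one_mem_WleZ {g : ℕ} (w : Z2Star g) : 1 ∈ WleZ w := by
  obtain ⟨l, hl, rfl⟩ := exists_reduced w
  refine ⟨[], l, List.isChain_nil, hl, by simp [wordZ], rfl, ?_⟩
  cases l with
  | nil => exact Or.inr rfl
  | cons a l => exact shortlexLE_of_length_lt (by simp)

theorem WleZ_induction {g : ℕ} {w : Z2Star g} {p : Z2Star g → Prop} (one : p 1)
    (mul : ∀ i, ∀ v ∈ WleZ w, z2of i * v ∈ WleZ w → p v → p (z2of i * v))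
    {v : Z2Star g} (hv : v ∈ WleZ w) : p v := by
  obtain ⟨l, lw, hl, hlw, rfl, hw, hle⟩ := hv
  induction l with
  | nil => simpa [wordZ] using one
  | cons a l ih =>
    have hlt : ShortlexLE l lw :=
      shortlexLE_of_length_lt (by simpa using hle.length_le)
    have hmem : wordZ (a :: l) ∈ WleZ w := ⟨a :: l, lw, hl, hlw, rfl, hw, hle⟩
    rw [wordZ_cons] at hmem ⊢
    exact mul a _ ⟨l, lw, hl.tail, hlw, rfl, hw, hlt⟩ hmem (ih hl.tail hlt)

theorem finite_WleZ {g : ℕ} (w : Z2Star g) : (WleZ w).Finite := by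
  obtain ⟨lw, hlw, rfl⟩ := exists_reduced w
  refine ((List.finite_length_le (Fin g) lw.length).image wordZ).subset ?_
  rintro v ⟨l, l', hl, hl', rfl, hw, hle⟩
  obtain rfl := wordZ_injOn hl' hlw hw
  exact ⟨l, hle.length_le, rfl⟩

theorem finite_HerWleZ {g : ℕ} (w : Z2Star g) : (HerWleZ w).Finite := by
  refine ((finite_WleZ w).image2 (fun u v => u⁻¹ * v) (finite_WleZ w)).subset ?_
  rintro _ ⟨u, hu, v, hv, rfl⟩
  exact ⟨u, hu, v, hv, rfl⟩

theorem finite_Yle {h : ℕ} {Y : Type*} [Group Y] (y : Fin h → Y) (M : ℕ) : (Yle y M).Finite := by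
  refine ((List.finite_length_le (Fin h) M).image fun l => (l.map y).prod).subset ?_
  rintro _ ⟨l, hl, rfl⟩
  exact ⟨l, hl, rfl⟩

theorem finite_HerYle {h : ℕ} {Y : Type*} [Group Y] (y : Fin h → Y) (M : ℕ) :
    (HerYle y M).Finite := by
  refine ((finite_Yle y M).image2 (fun u v => u⁻¹ * v) (finite_Yle y M)).subset ?_
  rintro _ ⟨u, hu, v, hv, rfl⟩
  exact ⟨u, hu, v, hv, rfl⟩

theorem Yle_mono {h : ℕ} {Y : Type*} [Group Y] (y : Fin h → Y) {M N : ℕ} (hMN : M ≤ N) :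
    Yle y M ⊆ Yle y N := by
  rintro _ ⟨l, hl, rfl⟩
  exact ⟨l, hl.trans hMN, rfl⟩

theorem exists_mul_mem_Yle {h : ℕ} {Y : Type*} [Group Y] (y : Fin h → Y)
    (hY : ∀ η : Y, ∃ a b : List (Fin h), ((a.map y).prod)⁻¹ * (b.map y).prod = η)
    (T : Finset Y) : ∃ (s : Y) (N : ℕ), ∀ t ∈ T, s * t ∈ Yle y N := by
  classical
  induction T using Finset.induction_on with
  | empty => exact ⟨1, 0, by simp⟩
  | insert η T _ ih =>
    obtain ⟨s, N, hs⟩ := ih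
    obtain ⟨a, b, hab⟩ := hY (s * η)
    refine ⟨(a.map y).prod * s, max (a.length + N) b.length, fun t ht => ?_⟩
    rcases Finset.mem_insert.1 ht with rfl | ht
    · refine ⟨b, le_max_right _ _, ?_⟩
      rw [mul_assoc, ← hab, mul_inv_cancel_left]
    · obtain ⟨l, hl, hl'⟩ := hs t ht
      refine ⟨a ++ l, ?_, ?_⟩
      · rw [List.length_append]
        exact le_max_of_le_left (by omega)
      · rw [List.map_append, List.prod_append, hl', mul_assoc]

theorem countable_of_fractions {h : ℕ} {Y : Type*} [Group Y] (y : Fin h → Y)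
    (hY : ∀ η : Y, ∃ a b : List (Fin h), ((a.map y).prod)⁻¹ * (b.map y).prod = η) :
    Countable Y := by
  have : Function.Surjective fun p : List (Fin h) × List (Fin h) =>
      ((p.1.map y).prod)⁻¹ * (p.2.map y).prod := fun η => by
    obtain ⟨a, b, hab⟩ := hY η
    exact ⟨(a, b), hab⟩
  exact this.countable

instance countable_z2Star (g : ℕ) : Countable (Z2Star g) := by
  have : Function.Surjective (wordZ (g := g)) := fun v => by
    obtain ⟨l, -, hl⟩ := exists_reduced v
    exact ⟨l, hl⟩
  exact this.countable

/-- A positive semidefinite kernel is the Gram matrix of a family in a Hilbert space. -/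
theorem exists_gram_vectors {X : Type} [Countable X] (k : X → X → ℂ)
    (hk : ∀ x y, star (k x y) = k y x)
    (hpos : ∀ f : X →₀ ℂ, 0 ≤ (f.sum fun x z => f.sum fun y z' => star z * z' * k x y).re) :
    ∃ (F : Type) (_ : NormedAddCommGroup F) (_ : InnerProductSpace ℂ F) (_ : CompleteSpace F)
      (_ : TopologicalSpace.SeparableSpace F) (e : X → F),
      (∀ x y, ⟪e x, e y⟫ = k x y) ∧ DenseRange (Finsupp.linearCombination ℂ e) := by
  let core : PreInnerProductSpace.Core ℂ (X →₀ ℂ) :=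
    { inner := fun f f' => f.sum fun x z => f'.sum fun y z' => star z * z' * k x y
      conj_inner_symm := fun f f' => by
        rw [Finsupp.sum_comm]
        simp only [map_finsuppSum]
        refine Finsupp.sum_congr fun x _ => Finsupp.sum_congr fun y _ => ?_
        rw [← hk x y]
        simp [mul_comm]
      add_left := fun f f' f'' => by
        rw [Finsupp.sum_add_index'] <;> simp [← Finsupp.sum_add, add_mul]
      smul_left := fun f f' c => by
        rw [Finsupp.sum_smul_index] <;> simp [Finsupp.mul_sum, ← mul_assoc]
      re_inner_nonneg := hpos }
  let : SeminormedAddCommGroup (X →₀ ℂ) :=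
    InnerProductSpace.Core.toSeminormedAddCommGroup (𝕜 := ℂ)
  let : InnerProductSpace ℂ (X →₀ ℂ) := .ofCore _
  have hdense : DenseRange (Finsupp.linearCombination ℂ
      fun x : X => ((Finsupp.single x 1 : X →₀ ℂ) : UniformSpace.Completion (X →₀ ℂ))) := by
    refine (UniformSpace.Completion.denseRange_coe (α := X →₀ ℂ)).mono ?_
    rintro _ ⟨f, rfl⟩
    refine ⟨f, ?_⟩
    have h1 := map_finsuppSum (UniformSpace.Completion.toComplL (𝕜 := ℂ) (E := X →₀ ℂ)) f
      (fun x z => z • Finsupp.single x (1 : ℂ))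
    rw [Finsupp.linearCombination_apply]
    simp only [Finsupp.smul_single, smul_eq_mul, mul_one, Finsupp.sum_single] at h1
    rw [UniformSpace.Completion.coe_toComplL] at h1
    rw [h1]
    refine Finsupp.sum_congr fun x _ => ?_
    rw [← UniformSpace.Completion.coe_smul, Finsupp.smul_single, smul_eq_mul, mul_one]
  refine ⟨UniformSpace.Completion (X →₀ ℂ), inferInstance, inferInstance, inferInstance, ?_,
    fun x => ((Finsupp.single x 1 : X →₀ ℂ) : UniformSpace.Completion (X →₀ ℂ)), ?_, hdense⟩
  · have hs := ((Set.countable_range fun x : X =>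
      ((Finsupp.single x 1 : X →₀ ℂ) : UniformSpace.Completion (X →₀ ℂ))).isSeparable.span
        (R := ℂ)).closure
    rw [← Finsupp.range_linearCombination, LinearMap.coe_range, hdense.closure_range] at hs
    exact TopologicalSpace.isSeparable_univ_iff.1 hs
  · intro x y
    rw [UniformSpace.Completion.inner_coe]
    change (Finsupp.single x 1).sum (fun x z => (Finsupp.single y 1).sum
      fun y z' => star z * z' * k x y) = _
    simp

section Unitaries

variable {X F : Type*} [NormedAddCommGroup F] [InnerProductSpace ℂ F]

theorem isometryEquiv_ext_of_dense {e : X → F} (he : DenseRange (Finsupp.linearCombination ℂ e))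
    {U V : F ≃ₗᵢ[ℂ] F} (h : ∀ x, U (e x) = V (e x)) : U = V := by
  refine LinearIsometryEquiv.ext fun v => congrFun (he.equalizer U.continuous V.continuous ?_) v
  funext f
  simp only [Function.comp_apply, Finsupp.linearCombination_apply, map_finsuppSum, map_smul, h]

theorem exists_isometryEquiv_of_perm [CompleteSpace F] {e : X → F}
    (he : DenseRange (Finsupp.linearCombination ℂ e)) (σ : Equiv.Perm X)
    (hσ : ∀ x y, ⟪e (σ x), e (σ y)⟫ = ⟪e x, e y⟫) :
    ∃ U : F ≃ₗᵢ[ℂ] F, ∀ x, U (e x) = e (σ x) := by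
  have hnorm : ∀ f : X →₀ ℂ,
      ‖Finsupp.linearCombination ℂ e (Finsupp.domLCongr (R := ℂ) σ f)‖ =
        ‖Finsupp.linearCombination ℂ e f‖ := by
    intro f
    have hf : Finsupp.linearCombination ℂ e (Finsupp.domLCongr (R := ℂ) σ f) =
        f.sum fun x z => z • e (σ x) := by
      rw [Finsupp.linearCombination_apply, Finsupp.domLCongr_apply, Finsupp.domCongr_apply,
        Finsupp.equivMapDomain_eq_mapDomain, Finsupp.sum_mapDomain_index_inj σ.injective]
    rw [hf, Finsupp.linearCombination_apply]
    have : ⟪f.sum fun x z => z • e (σ x), f.sum fun x z => z • e (σ x)⟫ =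
        ⟪f.sum fun x z => z • e x, f.sum fun x z => z • e x⟫ := by
      simp only [Finsupp.sum, sum_inner, inner_sum, inner_smul_left, inner_smul_right, hσ]
    rw [inner_self_eq_norm_sq_to_K, inner_self_eq_norm_sq_to_K] at this
    exact (pow_left_inj₀ (norm_nonneg _) (norm_nonneg _) two_ne_zero).1 (by exact_mod_cast this)
  refine ⟨LinearEquiv.extendOfIsometry (Finsupp.domLCongr (R := ℂ) σ)
    (Finsupp.linearCombination ℂ e) (Finsupp.linearCombination ℂ e) he he hnorm, fun x => ?_⟩
  have h1 : e x = Finsupp.linearCombination ℂ e (Finsupp.single x 1) := by simp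
  rw [h1, LinearEquiv.extendOfIsometry_eq, Finsupp.domLCongr_single,
    Finsupp.linearCombination_single, one_smul]

theorem reflection_commute {K : Submodule ℂ F} [K.HasOrthogonalProjection] (U : F ≃ₗᵢ[ℂ] F)
    (h₁ : ∀ v ∈ K, U v ∈ K) (h₂ : ∀ v ∈ K, U.symm v ∈ K) (v : F) :
    K.reflection (U v) = U (K.reflection v) := by
  have hK : K.map (U.toLinearEquiv : F →ₗ[ℂ] F) = K := by
    refine le_antisymm ?_ fun v hv => ⟨U.symm v, h₂ v hv, by simp⟩
    rintro _ ⟨v, hv, rfl⟩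
    exact h₁ v hv
  have := Submodule.reflection_map_apply U K (U v)
  simpa only [hK, LinearIsometryEquiv.symm_apply_apply] using this

theorem reflection_orthogonal_span_swap [CompleteSpace F] {S : Set F} {a b : F} (hab : a - b ∈ S)
    (horth : ∀ s ∈ S, ⟪s, a + b⟫ = 0) : (Submodule.span ℂ S)ᗮ.reflection a = b := by
  have h1 : a + b ∈ (Submodule.span ℂ S)ᗮ := by
    rw [Submodule.mem_orthogonal]
    intro u hu
    induction hu using Submodule.span_induction with
    | mem x hx => exact horth x hx
    | zero => simp
    | add x y _ _ hx hy => rw [inner_add_left, hx, hy, add_zero]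
    | smul c x _ hx => rw [inner_smul_left, hx, mul_zero]
  have h2 : a - b ∈ (Submodule.span ℂ S)ᗮᗮ :=
    Submodule.le_orthogonal_orthogonal _ (Submodule.subset_span hab)
  have e1 := Submodule.reflection_mem_subspace_eq_self h1
  have e2 := Submodule.reflection_mem_subspace_orthogonalComplement_eq_neg h2
  have h3 : a = (2⁻¹ : ℂ) • ((a + b) + (a - b)) := by
    rw [add_add_sub_cancel, ← two_smul ℂ a, smul_smul]; norm_num
  conv_lhs => rw [h3]
  rw [map_smul, map_add, e1, e2, show a + b + -(a - b) = (2 : ℂ) • b by rw [two_smul]; abel,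
    smul_smul]
  norm_num

end Unitaries

/-- A positive semidefinite kernel on `ℤ₂^{*g} × 𝔜 × {1, …, K}`, invariant under left translation
by `𝔜` and under those left translations by generators of `ℤ₂^{*g}` which preserve `W_{≤ w}`,
comes on `W_{≤ w}` from a unitary representation. -/
theorem exists_representation {g K : ℕ} {Y : Type} [Group Y] [Countable Y] (w : Z2Star g)
    (k : (Z2Star g × Y) × Fin K → (Z2Star g × Y) × Fin K → ℂ)
    (hk : ∀ x y, star (k x y) = k y x)
    (hpos : ∀ f : (Z2Star g × Y) × Fin K →₀ ℂ,
      0 ≤ (f.sum fun x z => f.sum fun y z' => star z * z' * k x y).re)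
    (hkY : ∀ η x y, k ((1, η) * x.1, x.2) ((1, η) * y.1, y.2) = k x y)
    (hkZ : ∀ i x y, x.1.1 ∈ WleZ w → z2of i * x.1.1 ∈ WleZ w → y.1.1 ∈ WleZ w →
      z2of i * y.1.1 ∈ WleZ w → k ((z2of i, 1) * x.1, x.2) ((z2of i, 1) * y.1, y.2) = k x y) :
    ∃ (F : Type) (_ : NormedAddCommGroup F) (_ : InnerProductSpace ℂ F) (_ : CompleteSpace F)
      (_ : TopologicalSpace.SeparableSpace F) (π : Z2Star g × Y →* (F ≃ₗᵢ[ℂ] F)) (ξ : Fin K → F),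
      ∀ u ∈ WleZ w, ∀ v ∈ WleZ w, ∀ a b i j,
        ⟪π (u, a) (ξ i), π (v, b) (ξ j)⟫ = k ((u, a), i) ((v, b), j) := by
  obtain ⟨F, _, _, _, _, e, he, hd⟩ := exists_gram_vectors k hk hpos
  have hV : ∀ η : Y, ∃ U : F ≃ₗᵢ[ℂ] F, ∀ x, U (e x) = e ((1, η) * x.1, x.2) := fun η =>
    exists_isometryEquiv_of_perm hd ((Equiv.mulLeft ((1, η) : Z2Star g × Y)).prodCongr
      (Equiv.refl (Fin K))) fun x y => by
        simp only [he]
        exact hkY η x y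
  choose V hV using hV
  let VY : Y →* (F ≃ₗᵢ[ℂ] F) := MonoidHom.mk' V fun a b =>
    isometryEquiv_ext_of_dense hd fun x => by
      have : ((1, a * b) : Z2Star g × Y) * x.1 = (1, a) * ((1, b) * x.1) :=
        Prod.ext (by simp) (by simp [mul_assoc])
      rw [LinearIsometryEquiv.coe_mul, Function.comp_apply, hV, hV, hV, this]
  let S : Fin g → Set F := fun i =>
    {s | ∃ x, x.1.1 ∈ WleZ w ∧ z2of i * x.1.1 ∈ WleZ w ∧ s = e x - e ((z2of i, 1) * x.1, x.2)}
  let R : Fin g → (F ≃ₗᵢ[ℂ] F) := fun i => (Submodule.span ℂ (S i))ᗮ.reflection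
  have hzz : ∀ (i : Fin g) (x : Z2Star g × Y), (z2of i, 1) * ((z2of i, 1) * x) = x := by
    intro i x
    ext
    · simp [z2of_mul_cancel_left]
    · simp
  have hR : ∀ i x, x.1.1 ∈ WleZ w → z2of i * x.1.1 ∈ WleZ w →
      R i (e x) = e ((z2of i, 1) * x.1, x.2) := by
    intro i x hx hx'
    refine reflection_orthogonal_span_swap ⟨x, hx, hx', rfl⟩ ?_
    rintro _ ⟨y, hy, hy', rfl⟩
    have h1 := hkZ i y x hy hy' hx hx'
    have h2 := hkZ i y ((z2of i, 1) * x.1, x.2) hy hy' hx' (by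
      simpa [z2of_mul_cancel_left] using hx)
    simp only [hzz] at h2
    simp only [inner_sub_left, inner_add_right, he]
    rw [h1, ← h2]
    ring
  have hVS : ∀ i η, ∀ v ∈ (Submodule.span ℂ (S i))ᗮ, V η v ∈ (Submodule.span ℂ (S i))ᗮ := by
    intro i η v hv
    have hv' : ∀ s ∈ S i, ⟪s, v⟫ = 0 := fun s hs =>
      (Submodule.mem_orthogonal _ _).1 hv s (Submodule.subset_span hs)
    rw [Submodule.mem_orthogonal]
    intro u hu
    induction hu using Submodule.span_induction with
    | zero => simp
    | add x y _ _ hx hy => rw [inner_add_left, hx, hy, add_zero]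
    | smul c x _ hx => rw [inner_smul_left, hx, mul_zero]
    | mem s hs =>
      obtain ⟨x, hx, hx', rfl⟩ := hs
      have h1 : e x - e ((z2of i, 1) * x.1, x.2) =
          V η (e ((1, η⁻¹) * x.1, x.2) - e ((z2of i, 1) * ((1, η⁻¹) * x.1), x.2)) := by
        simp only [map_sub, hV, ← mul_assoc, Prod.mk_mul_mk, mul_one, one_mul, mul_inv_cancel]
        rw [← Prod.one_eq_mk, one_mul]
      rw [h1, LinearIsometryEquiv.inner_map_map]
      exact hv' _ ⟨((1, η⁻¹) * x.1, x.2), by simpa using hx, by simpa using hx', rfl⟩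
  have hsymm : ∀ η, (V η).symm = V η⁻¹ := fun η => (map_inv VY η).symm
  have hcomm : ∀ i η, Commute (R i) (V η) := fun i η =>
    LinearIsometryEquiv.ext fun v => reflection_commute (V η) (hVS i η)
      (by rw [hsymm]; exact hVS i η⁻¹) v
  let RZ : Z2Star g →* (F ≃ₗᵢ[ℂ] F) := z2Lift R fun i => Submodule.reflection_mul_reflection _
  have hcomm' : ∀ v η, Commute (RZ v) (VY η) := by
    intro v η
    induction v using z2Star_induction with
    | one => rw [map_one]; exact Commute.one_left _
    | mul i v hv =>
      rw [map_mul, z2Lift_z2of]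
      exact (hcomm i η).mul_left hv
  have hπ : ∀ v ∈ WleZ w, ∀ b j, (RZ.noncommCoprod VY hcomm') (v, b) (e (1, j)) =
      e ((v, b), j) := by
    intro v hv b j
    rw [MonoidHom.noncommCoprod_apply, LinearIsometryEquiv.coe_mul, Function.comp_apply]
    change RZ v (V b (e (1, j))) = _
    rw [hV]
    refine WleZ_induction (p := fun v => RZ v (e ((1, b) * (1, j).1, (1, j).2)) = e ((v, b), j))
      ?_ (fun i v hv hv' ih => ?_) hv
    · rw [map_one, mul_one]; rfl
    · rw [map_mul, LinearIsometryEquiv.coe_mul, Function.comp_apply, ih, z2Lift_z2of,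
        hR i _ hv hv', Prod.mk_mul_mk, one_mul]
  exact ⟨F, _, _, inferInstance, inferInstance, RZ.noncommCoprod VY hcomm', fun j => e (1, j),
    fun u hu v hv a b i j => by rw [hπ u hu, hπ v hv, he]⟩

theorem exists_separating_functional {E : Type*} [AddCommGroup E] [Module ℝ E]
    (s : PointedCone ℝ E) (u a : E) (hus : u ∈ s) (hu : ∀ e, ∃ N : ℝ, N • u + e ∈ s)
    (ha : a ∉ s) :
    ∃ L : E →ₗ[ℝ] ℝ, (∀ x ∈ s, 0 ≤ L x) ∧ L a ≤ 0 ∧ 0 < L u := by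
  have smul_mem : ∀ (r : ℝ), 0 ≤ r → ∀ x ∈ s, r • x ∈ s := fun r hr x hx =>
    s.smul_mem hr hx
  have hu0 : u ≠ 0 := by
    rintro rfl
    obtain ⟨N, hN⟩ := hu a
    exact ha (by simpa using hN)
  have hneg : ∀ c t : ℝ, c < 0 → 0 ≤ t → c • u + t • a ∉ s := by
    intro c t hc ht h
    rcases ht.eq_or_lt with rfl | ht
    · obtain ⟨N, hN⟩ := hu a
      rw [zero_smul, add_zero] at h
      have h1 := s.add_mem (smul_mem (max N 0 * (-c)⁻¹)
        (mul_nonneg (le_max_right _ _) (inv_nonneg.2 (by linarith))) _ h)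
        (s.add_mem (smul_mem (max N 0 - N) (sub_nonneg.2 (le_max_left _ _)) _ hus) hN)
      rw [smul_smul, mul_assoc, inv_neg, neg_mul, inv_mul_cancel₀ hc.ne] at h1
      refine ha ?_
      convert h1 using 1
      module
    · have h1 := smul_mem t⁻¹ (by positivity) _
        (s.add_mem (smul_mem (-c) (by linarith) _ hus) h)
      rw [← add_assoc, ← add_smul, neg_add_cancel, zero_smul, zero_add, smul_smul,
        inv_mul_cancel₀ ht.ne', one_smul] at h1
      exact ha h1
  let s' : PointedCone ℝ E :=
    { carrier := {x | ∃ t : ℝ, 0 ≤ t ∧ x + t • a ∈ s}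
      add_mem' := by
        rintro x x' ⟨t, ht, h⟩ ⟨t', ht', h'⟩
        refine ⟨t + t', add_nonneg ht ht', ?_⟩
        convert s.add_mem h h' using 1
        module
      zero_mem' := ⟨0, le_rfl, by simp⟩
      smul_mem' := by
        rintro ⟨r, hr⟩ x ⟨t, ht, h⟩
        refine ⟨r * t, mul_nonneg hr ht, ?_⟩
        convert smul_mem r hr _ h using 1
        change r • x + _ = _
        module }
  obtain ⟨L, hL, hL'⟩ := riesz_extension s' (LinearPMap.mkSpanSingleton u (1 : ℝ) hu0)
    (by
      rintro ⟨x, hx⟩ ⟨t, ht, h⟩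
      obtain ⟨c, rfl⟩ := Submodule.mem_span_singleton.1 hx
      have hcu := LinearPMap.mkSpanSingleton'_apply u (1 : ℝ) (fun c hc => by
        rw [(smul_eq_zero.1 hc).resolve_right hu0, map_zero, zero_smul]) c hx
      by_contra! hc
      refine hneg c t ?_ ht h
      exact lt_of_eq_of_lt (hcu.trans (mul_one c)).symm hc)
    (by
      intro e
      obtain ⟨N, hN⟩ := hu e
      exact ⟨⟨N • u, Submodule.smul_mem _ _ (Submodule.mem_span_singleton_self u)⟩, 0, le_rfl,
        by simpa using hN⟩)
  refine ⟨L, fun x hx => hL' x ⟨0, le_rfl, by simpa using hx⟩, ?_, ?_⟩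
  · have := hL' (-a) ⟨1, zero_le_one, by simp⟩
    rw [map_neg] at this
    linarith
  · have := hL ⟨u, Submodule.mem_span_singleton_self u⟩
    rw [LinearPMap.mkSpanSingleton_apply] at this
    rw [this]
    exact one_pos

section SumsOfSquares

open scoped Classical in
/-- The trigonometric polynomial attached to an array of coefficients `(β, i), (γ, j)`, of which
only those with `β, γ ∈ D` are kept. -/
noncomputable def coefMap {G : Type*} [Group G] {K : ℕ} (D : Set G) :
    ((G × Fin K) × (G × Fin K) →₀ ℂ) →ₗ[ℂ] (G × Fin K × Fin K →₀ ℂ) :=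
  Finsupp.linearCombination ℂ fun p =>
    if p.1.1 ∈ D ∧ p.2.1 ∈ D then Finsupp.single (p.1.1⁻¹ * p.2.1, p.1.2, p.2.2) 1 else 0

/-- The conjugate transpose of an array. -/
noncomputable def arrayStar {X : Type*} : (X × X →₀ ℂ) →ₗ[ℝ] (X × X →₀ ℂ) where
  toFun e := (Finsupp.equivMapDomain (Equiv.prodComm X X) e).mapRange star (star_zero ℂ)
  map_add' e e' := by
    ext p
    simp [Finsupp.equivMapDomain_apply]
  map_smul' r e := by
    ext p
    simp [Finsupp.equivMapDomain_apply]

theorem arrayStar_single {X : Type*} (x y : X) (z : ℂ) :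
    arrayStar (Finsupp.single (x, y) z) = Finsupp.single (y, x) (star z) := by
  simp [arrayStar, Finsupp.equivMapDomain_single]

theorem arrayStar_arrayStar {X : Type*} (e : X × X →₀ ℂ) : arrayStar (arrayStar e) = e := by
  ext p
  simp [arrayStar, Finsupp.equivMapDomain_apply]

theorem arrayStar_I_smul {X : Type*} (e : X × X →₀ ℂ) :
    arrayStar (Complex.I • e) = -(Complex.I • arrayStar e) := by
  ext p
  simp [arrayStar, Finsupp.equivMapDomain_apply]

/-- The array `(x, y) ↦ conj (b x) * c y`. -/
noncomputable def outer {X : Type*} (b c : X →₀ ℂ) : X × X →₀ ℂ :=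
  b.sum fun x z => c.sum fun y z' => Finsupp.single (x, y) (star z * z')

theorem outer_add_left {X : Type*} (b b' c : X →₀ ℂ) :
    outer (b + b') c = outer b c + outer b' c := by
  rw [outer, Finsupp.sum_add_index'] <;> simp [outer, add_mul, Finsupp.sum_add]

theorem outer_add_right {X : Type*} (b c c' : X →₀ ℂ) :
    outer b (c + c') = outer b c + outer b c' := by
  simp only [outer, ← Finsupp.sum_add]
  refine Finsupp.sum_congr fun x _ => ?_
  rw [Finsupp.sum_add_index'] <;> simp [mul_add]

theorem outer_single_single {X : Type*} (x y : X) (z z' : ℂ) :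
    outer (Finsupp.single x z) (Finsupp.single y z') = Finsupp.single (x, y) (star z * z') := by
  simp [outer]

theorem arrayStar_outer {X : Type*} (b : X →₀ ℂ) : arrayStar (outer b b) = outer b b := by
  simp only [outer, map_finsuppSum, arrayStar_single]
  rw [Finsupp.sum_comm]
  refine Finsupp.sum_congr fun x _ => Finsupp.sum_congr fun y _ => ?_
  simp [mul_comm]

variable {G : Type*} [Group G] {K : ℕ}

theorem coefMap_single {D : Set G} {x y : G × Fin K} (hx : x.1 ∈ D) (hy : y.1 ∈ D) (z : ℂ) :
    coefMap D (Finsupp.single (x, y) z) = Finsupp.single (x.1⁻¹ * y.1, x.2, y.2) z := by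
  simp [coefMap, hx, hy]

theorem coefMap_single_of_not {D : Set G} {x y : G × Fin K} (h : ¬ (x.1 ∈ D ∧ y.1 ∈ D)) (z : ℂ) :
    coefMap D (Finsupp.single (x, y) z) = 0 := by
  simp [coefMap, h]

/-- The cone of sums of squares of analytic polynomials supported on `D`. -/
noncomputable def sosCone (K : ℕ) (D : Set G) : PointedCone ℝ (G × Fin K × Fin K →₀ ℂ) :=
  Submodule.span _ (Set.range fun b : G × Fin K →₀ ℂ => coefMap D (outer b b))

/-- The cone of arrays whose Hermitian part gives a sum of squares. -/
noncomputable def arrayCone (K : ℕ) (D : Set G) :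
    PointedCone ℝ ((G × Fin K) × (G × Fin K) →₀ ℂ) :=
  PointedCone.comap (((coefMap D).restrictScalars ℝ).comp (LinearMap.id + arrayStar))
    (sosCone K D)

theorem mem_arrayCone {D : Set G} {e : (G × Fin K) × (G × Fin K) →₀ ℂ} :
    e ∈ arrayCone K D ↔ coefMap D (e + arrayStar e) ∈ sosCone K D := Iff.rfl

theorem coefMap_outer_mem (D : Set G) (b : G × Fin K →₀ ℂ) :
    coefMap D (outer b b) ∈ sosCone K D := Submodule.subset_span ⟨b, rfl⟩

theorem outer_mem_arrayCone (D : Set G) (b : G × Fin K →₀ ℂ) :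
    outer b b ∈ arrayCone K D := by
  rw [mem_arrayCone, arrayStar_outer, map_add]
  exact add_mem (coefMap_outer_mem D b) (coefMap_outer_mem D b)

theorem smul_mem_sosCone {D : Set G} {r : ℝ} (hr : 0 ≤ r) {p : G × Fin K × Fin K →₀ ℂ}
    (hp : p ∈ sosCone K D) : r • p ∈ sosCone K D :=
  (sosCone K D).smul_mem hr hp

/-- The array of the constant polynomial with value the identity matrix. -/
noncomputable def unitArray (G : Type*) [Group G] (K : ℕ) : (G × Fin K) × (G × Fin K) →₀ ℂ :=
  ∑ i : Fin K, Finsupp.single ((1, i), (1, i)) 1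

theorem arrayStar_unitArray : arrayStar (unitArray G K) = unitArray G K := by
  simp [unitArray, map_sum, arrayStar_single]

theorem single_diag_mem_sosCone {D : Set G} (hD : 1 ∈ D) (i : Fin K) :
    Finsupp.single (1, i, i) 1 ∈ sosCone K D := by
  have := coefMap_outer_mem D (Finsupp.single ((1 : G), i) 1)
  rw [outer_single_single, coefMap_single hD hD] at this
  simpa using this

theorem coefMap_unitArray {D : Set G} (hD : 1 ∈ D) :
    coefMap D (unitArray G K) = ∑ i : Fin K, Finsupp.single (1, i, i) 1 := by
  rw [unitArray, map_sum]
  refine Finset.sum_congr rfl fun i _ => ?_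
  rw [coefMap_single (x := ((1 : G), i)) (y := ((1 : G), i)) hD hD, inv_one, one_mul]

theorem unitArray_mem_arrayCone {D : Set G} (hD : 1 ∈ D) : unitArray G K ∈ arrayCone K D := by
  rw [mem_arrayCone, arrayStar_unitArray, map_add, coefMap_unitArray hD]
  have := sum_mem fun i (_ : i ∈ Finset.univ) => single_diag_mem_sosCone (K := K) hD i
  exact add_mem this this

theorem coefMap_unitArray_sub_mem {D : Set G} (hD : 1 ∈ D) (i : Fin K) :
    coefMap D (unitArray G K) - Finsupp.single (1, i, i) 1 ∈ sosCone K D := by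
  rw [coefMap_unitArray hD, ← Finset.sum_erase_add _ _ (Finset.mem_univ i), add_sub_cancel_right]
  exact sum_mem fun i _ => single_diag_mem_sosCone hD i

theorem exists_smul_unitArray_add_mem {D : Set G} (hD : 1 ∈ D)
    (e : (G × Fin K) × (G × Fin K) →₀ ℂ) :
    ∃ N : ℝ, N • unitArray G K + e ∈ arrayCone K D := by
  induction e using Finsupp.induction_linear with
  | zero => exact ⟨0, by simp⟩
  | add e e' h h' =>
    obtain ⟨N, hN⟩ := h
    obtain ⟨N', hN'⟩ := h'
    refine ⟨N + N', ?_⟩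
    convert add_mem hN hN' using 1
    module
  | single p z =>
    obtain ⟨x, y⟩ := p
    by_cases h : x.1 ∈ D ∧ y.1 ∈ D
    · have h1 := coefMap_outer_mem D (Finsupp.single x 1 + Finsupp.single y z)
      simp only [outer_add_left, outer_add_right, outer_single_single, map_add,
        coefMap_single h.1 h.1, coefMap_single h.1 h.2, coefMap_single h.2 h.1,
        coefMap_single h.2 h.2, inv_mul_cancel, star_one, one_mul, mul_one] at h1
      have hz : star z * z = ((‖z‖ ^ 2 : ℝ) : ℂ) := by
        rw [Complex.star_def, Complex.conj_mul']
        push_cast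
        rfl
      have hz' : Finsupp.single ((1 : G), y.2, y.2) (star z * z) =
          (‖z‖ ^ 2 : ℝ) • Finsupp.single ((1 : G), y.2, y.2) (1 : ℂ) := by
        rw [hz, Finsupp.smul_single]
        simp
      rw [hz'] at h1
      refine ⟨(1 + ‖z‖ ^ 2) / 2, ?_⟩
      rw [mem_arrayCone, map_add arrayStar, map_smul arrayStar, arrayStar_unitArray,
        arrayStar_single]
      have h2 := add_mem (add_mem h1 (coefMap_unitArray_sub_mem hD x.2))
        (smul_mem_sosCone (sq_nonneg ‖z‖) (coefMap_unitArray_sub_mem hD y.2))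
      convert h2 using 1
      simp only [map_add, LinearMap.map_smul_of_tower, coefMap_single h.1 h.2,
        coefMap_single h.2 h.1]
      module
    · refine ⟨0, ?_⟩
      rw [mem_arrayCone, zero_smul, zero_add, map_add, arrayStar_single, coefMap_single_of_not h,
        coefMap_single_of_not (fun h' => h h'.symm), add_zero]
      exact zero_mem _

theorem coefMap_single_congr {D : Set G} {x y x' y' : G} (h : x ∈ D ∧ y ∈ D ↔ x' ∈ D ∧ y' ∈ D)
    (hxy : x⁻¹ * y = x'⁻¹ * y') (i j : Fin K) (z : ℂ) :
    coefMap D (Finsupp.single ((x, i), (y, j)) z) =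
      coefMap D (Finsupp.single ((x', i), (y', j)) z) := by
  by_cases hx : x ∈ D ∧ y ∈ D
  · have hx' := h.1 hx
    rw [coefMap_single (x := (x, i)) (y := (y, j)) hx.1 hx.2,
      coefMap_single (x := (x', i)) (y := (y', j)) hx'.1 hx'.2, hxy]
  · rw [coefMap_single_of_not (x := (x, i)) (y := (y, j)) hx,
      coefMap_single_of_not (x := (x', i)) (y := (y', j)) (fun h' => hx (h.2 h'))]

section Functional

variable {D : Set G} {L : ((G × Fin K) × (G × Fin K) →₀ ℂ) →ₗ[ℝ] ℝ}

theorem eq_of_coefMap_eq (hL : ∀ e ∈ arrayCone K D, 0 ≤ L e)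
    {e e' : (G × Fin K) × (G × Fin K) →₀ ℂ}
    (h : coefMap D (e + arrayStar e) = coefMap D (e' + arrayStar e')) : L e = L e' := by
  have key : ∀ e e' : (G × Fin K) × (G × Fin K) →₀ ℂ,
      coefMap D (e + arrayStar e) = coefMap D (e' + arrayStar e') → L e' ≤ L e := by
    intro e e' h
    have h1 : e - e' ∈ arrayCone K D := by
      rw [mem_arrayCone, map_sub arrayStar, sub_add_sub_comm, map_sub, h, sub_self]
      exact zero_mem _
    have h2 := hL _ h1
    rw [map_sub] at h2
    linarith
  exact le_antisymm (key _ _ h.symm) (key _ _ h)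

theorem map_arrayStar (hL : ∀ e ∈ arrayCone K D, 0 ≤ L e)
    (e : (G × Fin K) × (G × Fin K) →₀ ℂ) : L (arrayStar e) = L e :=
  eq_of_coefMap_eq hL (by rw [arrayStar_arrayStar, add_comm])

/-- The complex kernel representing the real functional `L`. -/
noncomputable def functionalKernel {X : Type*} (L : (X × X →₀ ℂ) →ₗ[ℝ] ℝ) (x y : X) : ℂ :=
  ⟨L (Finsupp.single (x, y) 1), -L (Finsupp.single (x, y) Complex.I)⟩

theorem re_mul_functionalKernel {X : Type*} (L : (X × X →₀ ℂ) →ₗ[ℝ] ℝ) (x y : X) (z : ℂ) :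
    (z * functionalKernel L x y).re = L (Finsupp.single (x, y) z) := by
  have h : Finsupp.single (x, y) z =
      z.re • Finsupp.single (x, y) (1 : ℂ) + z.im • Finsupp.single (x, y) Complex.I := by
    rw [Finsupp.smul_single, Finsupp.smul_single, ← Finsupp.single_add]
    congr 1
    rw [Complex.real_smul, Complex.real_smul, mul_one, Complex.re_add_im]
  rw [h, map_add, map_smul, map_smul, functionalKernel, Complex.mul_re, smul_eq_mul, smul_eq_mul]
  ring

theorem im_mul_functionalKernel {X : Type*} (L : (X × X →₀ ℂ) →ₗ[ℝ] ℝ) (x y : X) (z : ℂ) :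
    (z * functionalKernel L x y).im = -L (Complex.I • Finsupp.single (x, y) z) := by
  rw [Finsupp.smul_single, smul_eq_mul, ← re_mul_functionalKernel, mul_assoc, Complex.I_mul_re,
    neg_neg]

theorem star_functionalKernel (hL : ∀ e ∈ arrayCone K D, 0 ≤ L e) (x y : G × Fin K) :
    star (functionalKernel L x y) = functionalKernel L y x := by
  have h1 := map_arrayStar hL (Finsupp.single (x, y) 1)
  have h2 := map_arrayStar hL (Finsupp.single (x, y) Complex.I)
  rw [arrayStar_single, star_one] at h1
  rw [arrayStar_single, Complex.star_def, Complex.conj_I, Finsupp.single_neg, map_neg] at h2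
  apply Complex.ext
  · exact h1.symm
  · change - -L _ = -L _
    rw [← h2, neg_neg]

theorem functionalKernel_nonneg (hL : ∀ e ∈ arrayCone K D, 0 ≤ L e) (f : G × Fin K →₀ ℂ) :
    0 ≤ (f.sum fun x z => f.sum fun y z' => star z * z' * functionalKernel L x y).re := by
  have h := hL _ (outer_mem_arrayCone D f)
  simpa only [outer, Finsupp.sum, map_sum, Complex.re_sum, re_mul_functionalKernel] using h

theorem functionalKernel_mul_left (hL : ∀ e ∈ arrayCone K D, 0 ≤ L e) (c : G) (x y : G × Fin K)
    (h : c * x.1 ∈ D ∧ c * y.1 ∈ D ↔ x.1 ∈ D ∧ y.1 ∈ D) :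
    functionalKernel L (c * x.1, x.2) (c * y.1, y.2) = functionalKernel L x y := by
  have key : ∀ z : ℂ, L (Finsupp.single ((c * x.1, x.2), (c * y.1, y.2)) z) =
      L (Finsupp.single (x, y) z) := by
    intro z
    refine eq_of_coefMap_eq hL ?_
    rw [map_add, map_add, arrayStar_single, arrayStar_single,
      coefMap_single_congr h (by group),
      coefMap_single_congr (and_comm.trans (h.trans and_comm)) (by group)]
  rw [functionalKernel, functionalKernel, key, key]

end Functional

open scoped Classical in
/-- The restriction of the coefficients `b` to `D`. -/
noncomputable def restrictCoef (D : Set G) (b : G × Fin K →₀ ℂ) (x : G × Fin K) : ℂ :=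
  if x.1 ∈ D then b x else 0

theorem coefMap_outer_apply {D : Set G} {b : G × Fin K →₀ ℂ} {S : Finset G}
    (hS : ∀ x ∈ b.support, x.1 ∈ D → x.1 ∈ S) (α : G) (i j : Fin K) :
    coefMap D (outer b b) (α, i, j) =
      ∑ β ∈ S, star (restrictCoef D b (β, i)) * restrictCoef D b (β * α, j) := by
  classical
  have h1 : ∀ x y : G × Fin K, coefMap D (Finsupp.single (x, y) (star (b x) * b y)) (α, i, j) =
      if y = (x.1 * α, j) then
        (if x.2 = i then star (restrictCoef D b x) * restrictCoef D b y else 0) else 0 := by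
    rintro ⟨β, i'⟩ ⟨γ, j'⟩
    by_cases h : β ∈ D ∧ γ ∈ D
    · rw [coefMap_single (x := (β, i')) (y := (γ, j')) h.1 h.2, Finsupp.single_apply]
      simp only [Prod.mk.injEq, restrictCoef, h.1, h.2, if_true, inv_mul_eq_iff_eq_mul]
      by_cases h1 : γ = β * α <;> by_cases h2 : i' = i <;> by_cases h3 : j' = j <;>
        simp [h1, h2, h3]
    · rw [coefMap_single_of_not (x := (β, i')) (y := (γ, j')) h]
      rcases not_and_or.1 h with h | h <;> simp [restrictCoef, h]
  have h2 : coefMap D (outer b b) (α, i, j) = ∑ x ∈ b.support,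
      if x.2 = i then star (restrictCoef D b x) * restrictCoef D b (x.1 * α, j) else 0 := by
    simp only [outer, Finsupp.sum, map_sum, Finsupp.finsetSum_apply, h1]
    refine Finset.sum_congr rfl fun x _ => ?_
    rw [Finset.sum_ite_eq']
    split_ifs with h h' h'
    · rfl
    · rfl
    · rw [restrictCoef, restrictCoef]
      simp [Finsupp.notMem_support_iff.1 h]
    · rfl
  have h3 : ∑ β ∈ S, star (restrictCoef D b (β, i)) * restrictCoef D b (β * α, j) =
      ∑ x ∈ S ×ˢ (Finset.univ : Finset (Fin K)),
        if x.2 = i then star (restrictCoef D b x) * restrictCoef D b (x.1 * α, j) else 0 := by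
    rw [Finset.sum_product]
    simp
  rw [h2, h3, Finset.sum_subset (Finset.subset_union_left (s₂ := S ×ˢ Finset.univ))]
  · refine (Finset.sum_subset Finset.subset_union_right fun x hx hxS => ?_).symm
    have hxD : x.1 ∉ D := fun h => by
      rcases Finset.mem_union.1 hx with h' | h'
      · exact hxS (Finset.mem_product.2 ⟨hS x h' h, Finset.mem_univ _⟩)
      · exact hxS h'
    simp [restrictCoef, hxD]
  · intro x _ hx
    simp [restrictCoef, Finsupp.notMem_support_iff.1 hx]

theorem norm_apply_le_of_mem_sosCone {D : Set G} {q : G × Fin K × Fin K →₀ ℂ}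
    (hq : q ∈ sosCone K D) (p : G × Fin K × Fin K) : ‖q p‖ ≤ (∑ m : Fin K, q (1, m, m)).re := by
  classical
  induction hq using Submodule.span_induction with
  | mem q hq =>
    obtain ⟨b, rfl⟩ := hq
    obtain ⟨α, i, j⟩ := p
    let S := b.support.image Prod.fst
    have hS : ∀ x ∈ b.support, x.1 ∈ D → x.1 ∈ S := fun x hx _ => Finset.mem_image_of_mem _ hx
    let f : Fin K → G → ℝ := fun m β => ‖restrictCoef D b (β, m)‖ ^ 2
    have hf0 : ∀ m β, 0 ≤ f m β := fun m β => sq_nonneg _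
    have hf : ∀ m, ∀ β ∉ S, f m β = 0 := by
      intro m β hβ
      have : b (β, m) = 0 := by
        by_contra h
        exact hβ (Finset.mem_image.2 ⟨(β, m), Finsupp.mem_support_iff.2 h, rfl⟩)
      simp [f, restrictCoef, this]
    have htr : (∑ m : Fin K, coefMap D (outer b b) (1, m, m)).re = ∑ m, ∑ β ∈ S, f m β := by
      simp only [coefMap_outer_apply hS, mul_one, Complex.re_sum, Complex.star_def,
        Complex.conj_mul', f]
      refine Finset.sum_congr rfl fun m _ => Finset.sum_congr rfl fun β _ => ?_
      norm_cast
    have hle : ∀ m, ∑ β ∈ S, f m β ≤ ∑ m, ∑ β ∈ S, f m β := fun m =>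
      Finset.single_le_sum (f := fun m => ∑ β ∈ S, f m β)
        (fun m _ => Finset.sum_nonneg fun β _ => hf0 m β) (Finset.mem_univ m)
    have hshift : ∑ β ∈ S, f j (β * α) ≤ ∑ β ∈ S, f j β := by
      rw [← Finset.sum_image (f := f j) (g := fun β => β * α)
        (fun β _ γ _ h => mul_right_cancel h), ← Finset.sum_filter_ne_zero]
      refine Finset.sum_le_sum_of_subset_of_nonneg (fun β hβ => ?_) fun β _ _ => hf0 j β
      by_contra h
      exact (Finset.mem_filter.1 hβ).2 (hf j β h)
    change ‖coefMap D (outer b b) (α, i, j)‖ ≤ (∑ m : Fin K, coefMap D (outer b b) (1, m, m)).re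
    rw [htr, coefMap_outer_apply hS]
    calc ‖∑ β ∈ S, star (restrictCoef D b (β, i)) * restrictCoef D b (β * α, j)‖
        ≤ ∑ β ∈ S, (f i β + f j (β * α)) / 2 := by
          refine (norm_sum_le _ _).trans (Finset.sum_le_sum fun β _ => ?_)
          rw [norm_mul, norm_star]
          have := two_mul_le_add_sq ‖restrictCoef D b (β, i)‖ ‖restrictCoef D b (β * α, j)‖
          simp only [f]
          linarith
      _ ≤ ∑ m, ∑ β ∈ S, f m β := by
          rw [← Finset.sum_div, Finset.sum_add_distrib]
          linarith [hle i, hle j]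
  | zero => simp
  | add q q' _ _ h h' =>
    simp only [Finsupp.add_apply, Finset.sum_add_distrib, Complex.add_re]
    exact (norm_add_le _ _).trans (add_le_add h h')
  | smul r q _ h =>
    obtain ⟨r, hr⟩ := r
    change ‖(r • q) p‖ ≤ (∑ m : Fin K, (r • q) (1, m, m)).re
    simp only [Finsupp.smul_apply, ← Finset.smul_sum, Complex.smul_re, norm_smul,
      Real.norm_of_nonneg hr, smul_eq_mul]
    exact mul_le_mul_of_nonneg_left h hr

theorem eq_zero_of_forall_add_smul_mem_sosCone {D : Set G} {q v : G × Fin K × Fin K →₀ ℂ}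
    (h : ∀ t : ℝ, q + t • v ∈ sosCone K D) : v = 0 := by
  ext p
  by_contra hv
  have hv : 0 < ‖v p‖ := norm_pos_iff.2 hv
  set R := (∑ m : Fin K, q (1, m, m)).re with hR
  set V := (∑ m : Fin K, v (1, m, m)).re with hV
  have key : ∀ t : ℝ, ‖q p + t • v p‖ ≤ R + t * V := by
    intro t
    have := norm_apply_le_of_mem_sosCone (h t) p
    simpa only [Finsupp.add_apply, Finsupp.smul_apply, Finset.sum_add_distrib, ← Finset.smul_sum,
      Complex.add_re, Complex.smul_re, smul_eq_mul] using this
  have h2 : ∀ t : ℝ, 0 ≤ t → t * ‖v p‖ ≤ R := by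
    intro t ht
    have h3 : ‖(2 * t) • v p‖ ≤ ‖q p + t • v p‖ + ‖q p + (-t) • v p‖ := by
      have : (2 * t) • v p = (q p + t • v p) - (q p + (-t) • v p) := by module
      rw [this]
      exact norm_sub_le _ _
    rw [norm_smul, Real.norm_of_nonneg (by positivity)] at h3
    linarith [key t, key (-t)]
  have hR0 : 0 ≤ R := by simpa using h2 0 le_rfl
  have := h2 ((R + 1) / ‖v p‖) (by positivity)
  rw [div_mul_cancel₀ _ hv.ne'] at this
  linarith

theorem outer_smul {X : Type*} (c : ℂ) (b : X →₀ ℂ) :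
    outer (c • b) (c • b) = (star c * c) • outer b b := by
  simp only [outer]
  rw [Finsupp.sum_smul_index (by simp), Finsupp.smul_sum]
  refine Finsupp.sum_congr fun x _ => ?_
  rw [Finsupp.sum_smul_index (by simp), Finsupp.smul_sum]
  refine Finsupp.sum_congr fun y _ => ?_
  rw [Finsupp.smul_single, smul_eq_mul, star_mul']
  congr 1
  ring

theorem exists_list_of_mem_sosCone {D : Set G} {q : G × Fin K × Fin K →₀ ℂ}
    (hq : q ∈ sosCone K D) :
    ∃ l : List (G × Fin K →₀ ℂ), (l.map fun b => coefMap D (outer b b)).sum = q := by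
  induction hq using Submodule.span_induction with
  | mem q hq =>
    obtain ⟨b, rfl⟩ := hq
    exact ⟨[b], by simp⟩
  | zero => exact ⟨[], rfl⟩
  | add q q' _ _ h h' =>
    obtain ⟨l, rfl⟩ := h
    obtain ⟨l', rfl⟩ := h'
    exact ⟨l ++ l', by simp⟩
  | smul r q _ h =>
    obtain ⟨r, hr⟩ := r
    obtain ⟨l, rfl⟩ := h
    refine ⟨l.map fun b => ((√r : ℝ) : ℂ) • b, ?_⟩
    change _ = r • (l.map fun b => coefMap D (outer b b)).sum
    have hr' : star ((√r : ℝ) : ℂ) * ((√r : ℝ) : ℂ) = (r : ℂ) := by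
      rw [Complex.star_def, Complex.conj_ofReal, ← Complex.ofReal_mul, Real.mul_self_sqrt hr]
    rw [List.map_map, List.smul_sum, List.map_map]
    congr 2
    ext1 b
    rw [Function.comp_apply, Function.comp_apply, outer_smul, hr', map_smul, Complex.coe_smul]

/-- If every functional that is nonnegative on squares is positive at `e` and vanishes at `I • e`,
then the polynomial of `e` is a sum of squares. -/
theorem coefMap_mem_sosCone {D : Set G} (hD : 1 ∈ D) {e : (G × Fin K) × (G × Fin K) →₀ ℂ}
    (h : ∀ L : ((G × Fin K) × (G × Fin K) →₀ ℂ) →ₗ[ℝ] ℝ, (∀ e ∈ arrayCone K D, 0 ≤ L e) →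
      0 < L (unitArray G K) → 0 < L e ∧ L (Complex.I • e) = 0) :
    coefMap D e ∈ sosCone K D := by
  have hmem : ∀ t : ℝ, e + t • Complex.I • e ∈ arrayCone K D := by
    intro t
    by_contra hc
    obtain ⟨L, hL, hLe, hLu⟩ := exists_separating_functional _ _ _
      (unitArray_mem_arrayCone hD) (exists_smul_unitArray_add_mem hD) hc
    have h' := h L hL hLu
    rw [map_add, map_smul, h'.2, smul_zero, add_zero] at hLe
    exact hLe.not_gt h'.1
  have hzero : coefMap D (Complex.I • e + arrayStar (Complex.I • e)) = 0 := by
    refine eq_zero_of_forall_add_smul_mem_sosCone (D := D)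
      (q := coefMap D (e + arrayStar e)) fun t => ?_
    have := mem_arrayCone.1 (hmem t)
    convert this using 1
    rw [← LinearMap.map_smul_of_tower, ← map_add, map_add arrayStar, map_smul arrayStar]
    congr 1
    module
  have hstar : coefMap D (arrayStar e) = coefMap D e := by
    rw [arrayStar_I_smul, ← sub_eq_add_neg, ← smul_sub, map_smul, map_sub, smul_eq_zero] at hzero
    exact (sub_eq_zero.1 (hzero.resolve_left Complex.I_ne_zero)).symm
  have h0 := hmem 0
  rw [zero_smul, add_zero, mem_arrayCone, map_add, hstar] at h0
  convert smul_mem_sosCone (r := 2⁻¹) (by norm_num) h0 using 1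
  module

end SumsOfSquares

/-- Functionals that are nonnegative on squares come from representations, so they are positive on
a polynomial that is positive in every representation. -/
theorem functional_pos {g K : ℕ} {Y : Type} [Group Y] [Countable Y] {w : Z2Star g}
    {A : Z2Star g × Y → Matrix (Fin K) (Fin K) ℂ} {S : Finset (Z2Star g × Y)}
    (hpos : ∀ (F : Type) [NormedAddCommGroup F] [InnerProductSpace ℂ F]
        [CompleteSpace F] [TopologicalSpace.SeparableSpace F]
        (π : Z2Star g × Y →* (F ≃ₗᵢ[ℂ] F)) (ξ : Fin K → F), ξ ≠ 0 →
        0 < (∑ α ∈ S, ∑ i : Fin K, ∑ j : Fin K, A α i j * ⟪ξ i, π α (ξ j)⟫).re ∧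
        (∑ α ∈ S, ∑ i : Fin K, ∑ j : Fin K, A α i j * ⟪ξ i, π α (ξ j)⟫).im = 0)
    {p q : Z2Star g × Y → Z2Star g × Y}
    (hpq : ∀ α ∈ S, (p α).1 ∈ WleZ w ∧ (q α).1 ∈ WleZ w ∧ (p α)⁻¹ * q α = α)
    {L : (((Z2Star g × Y) × Fin K) × ((Z2Star g × Y) × Fin K) →₀ ℂ) →ₗ[ℝ] ℝ}
    (hL : ∀ e ∈ arrayCone K (Prod.fst ⁻¹' WleZ w), 0 ≤ L e)
    (hLu : 0 < L (unitArray (Z2Star g × Y) K)) :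
    0 < L (∑ α ∈ S, ∑ i : Fin K, ∑ j : Fin K, Finsupp.single ((p α, i), (q α, j)) (A α i j)) ∧
      L (Complex.I •
        ∑ α ∈ S, ∑ i : Fin K, ∑ j : Fin K, Finsupp.single ((p α, i), (q α, j)) (A α i j)) = 0 := by
  obtain ⟨F, _, _, _, _, π, ξ, hπ⟩ := exists_representation w (functionalKernel L)
    (star_functionalKernel hL) (functionalKernel_nonneg hL)
    (fun η x y => functionalKernel_mul_left hL _ x y (by simp))
    (fun i x y h1 h2 h3 h4 => functionalKernel_mul_left hL _ x y
      (iff_of_true ⟨h2, h4⟩ ⟨h1, h3⟩))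
  have hone := one_mem_WleZ w
  have hξ : ξ ≠ 0 := by
    rintro rfl
    have h0 : ∀ i : Fin K,
        L (Finsupp.single (((1 : Z2Star g × Y), i), ((1 : Z2Star g × Y), i)) 1) = 0 := by
      intro i
      rw [← re_mul_functionalKernel, one_mul]
      have := hπ 1 hone 1 hone 1 1 i i
      rw [Pi.zero_apply, map_zero, inner_zero_left] at this
      exact congrArg Complex.re this.symm
    rw [unitArray, map_sum, Finset.sum_eq_zero fun i _ => h0 i] at hLu
    exact hLu.false
  have hinner : ∀ α ∈ S, ∀ i j,
      ⟪ξ i, π α (ξ j)⟫ = functionalKernel L (p α, i) (q α, j) := by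
    intro α hα i j
    obtain ⟨h1, h2, h3⟩ := hpq α hα
    rw [← LinearIsometryEquiv.inner_map_map (π (p α))]
    have : π (p α) (π α (ξ j)) = π (q α) (ξ j) := by
      conv_rhs => rw [← mul_inv_cancel_left (p α) (q α), h3, map_mul]
      rfl
    rw [this]
    exact hπ _ h1 _ h2 _ _ i j
  have hsum : ∑ α ∈ S, ∑ i : Fin K, ∑ j : Fin K, A α i j * ⟪ξ i, π α (ξ j)⟫ =
      ∑ α ∈ S, ∑ i : Fin K, ∑ j : Fin K, A α i j * functionalKernel L (p α, i) (q α, j) :=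
    Finset.sum_congr rfl fun α hα => Finset.sum_congr rfl fun i _ =>
      Finset.sum_congr rfl fun j _ => by rw [hinner α hα]
  obtain ⟨hre, him⟩ := hpos F π ξ hξ
  rw [hsum] at hre him
  simp only [Complex.re_sum, re_mul_functionalKernel] at hre
  simp only [Complex.im_sum, im_mul_functionalKernel, Finset.sum_neg_distrib, neg_eq_zero] at him
  simp only [Finset.smul_sum, map_sum]
  exact ⟨hre, him⟩

theorem exists_list_of_forall_representation_pos {g K : ℕ} {Y : Type} [Group Y] [Countable Y]
    {w : Z2Star g} {A : Z2Star g × Y → Matrix (Fin K) (Fin K) ℂ} {S : Finset (Z2Star g × Y)}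
    (hS : ∀ α ∉ S, A α = 0) (hSw : ∀ α ∈ S, α.1 ∈ HerWleZ w)
    (hpos : ∀ (F : Type) [NormedAddCommGroup F] [InnerProductSpace ℂ F]
        [CompleteSpace F] [TopologicalSpace.SeparableSpace F]
        (π : Z2Star g × Y →* (F ≃ₗᵢ[ℂ] F)) (ξ : Fin K → F), ξ ≠ 0 →
        0 < (∑ α ∈ S, ∑ i : Fin K, ∑ j : Fin K, A α i j * ⟪ξ i, π α (ξ j)⟫).re ∧
        (∑ α ∈ S, ∑ i : Fin K, ∑ j : Fin K, A α i j * ⟪ξ i, π α (ξ j)⟫).im = 0) :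
    ∃ l : List ((Z2Star g × Y) × Fin K →₀ ℂ), ∀ α i j,
      A α i j =
        (l.map fun b => coefMap (Prod.fst ⁻¹' WleZ w) (outer b b) (α, i, j)).sum := by
  classical
  have hSpq : ∀ α : Z2Star g × Y, ∃ p q : Z2Star g × Y, α ∈ S →
      p.1 ∈ WleZ w ∧ q.1 ∈ WleZ w ∧ p⁻¹ * q = α := by
    intro α
    by_cases hα : α ∈ S
    · obtain ⟨u, hu, v, hv, huv⟩ := hSw α hα
      exact ⟨(u, 1), (v, α.2), fun _ => ⟨hu, hv, Prod.ext huv (by simp)⟩⟩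
    · exact ⟨1, 1, fun h => absurd h hα⟩
  choose p q hpq using hSpq
  have hmem := coefMap_mem_sosCone (G := Z2Star g × Y) (D := Prod.fst ⁻¹' WleZ w)
    (Set.mem_preimage.2 (one_mem_WleZ w)) fun L hL hLu => functional_pos hpos hpq hL hLu
  obtain ⟨l, hl⟩ := exists_list_of_mem_sosCone hmem
  refine ⟨l, fun α i j => ?_⟩
  have hcoef : coefMap (Prod.fst ⁻¹' WleZ w) (∑ α ∈ S, ∑ i : Fin K, ∑ j : Fin K,
      Finsupp.single ((p α, i), (q α, j)) (A α i j)) =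
      ∑ α ∈ S, ∑ i : Fin K, ∑ j : Fin K, Finsupp.single (α, i, j) (A α i j) := by
    simp only [map_sum]
    refine Finset.sum_congr rfl fun α hα => Finset.sum_congr rfl fun i _ =>
      Finset.sum_congr rfl fun j _ => ?_
    obtain ⟨h1, h2, h3⟩ := hpq α hα
    rw [coefMap_single (x := (p α, i)) (y := (q α, j)) h1 h2, h3]
  rw [hcoef] at hl
  have h := DFunLike.congr_fun hl (α, i, j)
  have hr : (∑ α ∈ S, ∑ i : Fin K, ∑ j : Fin K, Finsupp.single (α, i, j) (A α i j)) (α, i, j) =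
      A α i j := by
    have h1 : ∀ α' i' j', Finsupp.single (α', i', j') (A α' i' j') (α, i, j) =
        if j' = j then if i' = i then if α' = α then A α' i' j' else 0 else 0 else 0 := by
      intro α' i' j'
      rw [Finsupp.single_apply]
      by_cases h1 : α' = α <;> by_cases h2 : i' = i <;> by_cases h3 : j' = j <;>
        simp [h1, h2, h3]
    simp only [Finsupp.finsetSum_apply, h1, Finset.sum_ite_eq', Finset.mem_univ, if_true]
    split_ifs with hα
    · rfl
    · rw [hS α hα, Matrix.zero_apply]
  rw [hr] at h
  rw [← h]
  have : ∀ l : List ((Z2Star g × Y) × Fin K →₀ ℂ),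
      (l.map fun b => coefMap (Prod.fst ⁻¹' WleZ w) (outer b b)).sum (α, i, j) =
      (l.map fun b => coefMap (Prod.fst ⁻¹' WleZ w) (outer b b) (α, i, j)).sum := by
    intro l
    induction l with
    | nil => rfl
    | cons b l ih => rw [List.map_cons, List.sum_cons, Finsupp.add_apply, ih, List.map_cons,
        List.sum_cons]
  exact this l

theorem finsum_mem_conjTranspose_mul {G : Type*} [Group G] {m n : ℕ} {P : Set G} (hP : P.Finite)
    {B : G → Matrix (Fin m) (Fin n) ℂ} (hB : ∀ β ∉ P, B β = 0) (α : G) :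
    ∑ᶠ β ∈ P, ∑ᶠ γ ∈ {γ : G | γ ∈ P ∧ β⁻¹ * γ = α}, (B β)ᴴ * B γ =
      ∑ β ∈ hP.toFinset, (B β)ᴴ * B (β * α) := by
  rw [finsum_mem_eq_finite_toFinset_sum _ hP]
  refine Finset.sum_congr rfl fun β _ => ?_
  by_cases h : β * α ∈ P
  · have : {γ : G | γ ∈ P ∧ β⁻¹ * γ = α} = {β * α} := by
      ext γ
      simp only [Set.mem_ofPred_eq, Set.mem_singleton_iff, inv_mul_eq_iff_eq_mul]
      exact ⟨And.right, fun hγ => ⟨hγ ▸ h, hγ⟩⟩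
    rw [this, finsum_mem_singleton]
  · have : {γ : G | γ ∈ P ∧ β⁻¹ * γ = α} = ∅ := by
      ext γ
      simp only [Set.mem_ofPred_eq, inv_mul_eq_iff_eq_mul, Set.mem_empty_iff_false, iff_false]
      rintro ⟨hγ, rfl⟩
      exact h hγ
    rw [this, finsum_mem_empty, hB _ h, Matrix.mul_zero]

/-- Noncommutative Fejér–Riesz theorem for `ℤ₂^{*g} × 𝔜`. -/
theorem stmt1
    (g h K M : ℕ) (hg : 0 < g) (hh : 0 < h) (hK : 0 < K) (hM : 0 < M)
    (Y : Type) [Group Y] (y : Fin h → Y)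
    (hY : ∀ η : Y, ∃ a b : List (Fin h), ((a.map y).prod)⁻¹ * (b.map y).prod = η)
    (w : Z2Star g)
    (A : Z2Star g × Y → Matrix (Fin K) (Fin K) ℂ)
    (hAsupp : ∀ α, A α ≠ 0 → α ∈ (HerWleZ w) ×ˢ (HerYle y M))
    (hpos : ∀ (F : Type) [NormedAddCommGroup F] [InnerProductSpace ℂ F]
        [CompleteSpace F] [TopologicalSpace.SeparableSpace F]
        (π : Z2Star g × Y →* (F ≃ₗᵢ[ℂ] F)) (ξ : Fin K → F), ξ ≠ 0 →
        0 < (∑ᶠ α ∈ (HerWleZ w) ×ˢ (HerYle y M),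
              ∑ i : Fin K, ∑ j : Fin K, A α i j * ⟪ξ i, π α (ξ j)⟫).re ∧
        (∑ᶠ α ∈ (HerWleZ w) ×ˢ (HerYle y M),
              ∑ i : Fin K, ∑ j : Fin K, A α i j * ⟪ξ i, π α (ξ j)⟫).im = 0) :
    ∃ K' M' : ℕ, 0 < K' ∧ 0 < M' ∧
      ∃ B : Z2Star g × Y → Matrix (Fin K') (Fin K) ℂ,
        ∀ α : Z2Star g × Y,
          A α = ∑ᶠ β ∈ (WleZ w) ×ˢ (Yle y M'),
                  ∑ᶠ γ ∈ {γ : Z2Star g × Y |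
                            γ ∈ (WleZ w) ×ˢ (Yle y M') ∧ β⁻¹ * γ = α},
                    (B β)ᴴ * B γ := by
  classical
  have := countable_of_fractions y hY
  have hfin : ((HerWleZ w) ×ˢ (HerYle y M)).Finite := (finite_HerWleZ w).prod (finite_HerYle y M)
  obtain ⟨l, hl⟩ := exists_list_of_forall_representation_pos (w := w) (A := A)
    (S := hfin.toFinset) (fun α hα => by
      by_contra h
      exact hα (hfin.mem_toFinset.2 (hAsupp α h)))
    (fun α hα => (hfin.mem_toFinset.1 hα).1)
    (fun F _ _ _ _ π ξ hξ => by
      have h := hpos F π ξ hξ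
      rwa [finsum_mem_eq_finite_toFinset_sum _ hfin] at h)
  let D : Set (Z2Star g × Y) := Prod.fst ⁻¹' WleZ w
  let b : Fin (0 :: l).length → (Z2Star g × Y) × Fin K →₀ ℂ := fun k => (0 :: l).get k
  let T : Finset Y := Finset.univ.biUnion fun k => (b k).support.image fun x => x.1.2
  obtain ⟨s, N, hs⟩ := exists_mul_mem_Yle y hY T
  have hfinP : ((WleZ w) ×ˢ (Yle y (N + 1))).Finite :=
    (finite_WleZ w).prod (finite_Yle y (N + 1))
  let c : Z2Star g × Y := (1, s)
  have hsupp : ∀ k, ∀ x ∈ (b k).support, x.1 ∈ D → c * x.1 ∈ (WleZ w) ×ˢ (Yle y (N + 1)) := by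
    intro k x hx hxD
    refine ⟨?_, Yle_mono y N.le_succ (hs _ (Finset.mem_biUnion.2
      ⟨k, Finset.mem_univ k, Finset.mem_image.2 ⟨x, hx, rfl⟩⟩))⟩
    change 1 * x.1.1 ∈ WleZ w
    rwa [one_mul]
  let B : Z2Star g × Y → Matrix (Fin (0 :: l).length) (Fin K) ℂ := fun β =>
    Matrix.of fun k i => restrictCoef D (b k) (c⁻¹ * β, i)
  have hB : ∀ β ∉ (WleZ w) ×ˢ (Yle y (N + 1)), B β = 0 := by
    intro β hβ
    ext k i
    by_contra h
    have hD : c⁻¹ * β ∈ D := by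
      by_contra hD
      exact h (if_neg hD)
    have hx : b k (c⁻¹ * β, i) ≠ 0 := fun h0 => h ((if_pos hD).trans h0)
    have := hsupp k _ (Finsupp.mem_support_iff.2 hx) hD
    rw [mul_inv_cancel_left] at this
    exact hβ this
  refine ⟨(0 :: l).length, N + 1, Nat.succ_pos _, Nat.succ_pos _, B, fun α => ?_⟩
  rw [finsum_mem_conjTranspose_mul hfinP hB]
  ext i j
  have h1 : (l.map fun b => coefMap D (outer b b) (α, i, j)).sum =
      ∑ k, coefMap D (outer (b k) (b k)) (α, i, j) := by
    have h0 : coefMap D (outer 0 0) (α, i, j) = 0 := by simp [outer]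
    rw [← zero_add (List.sum _), ← h0, ← List.sum_cons,
      ← List.map_cons (f := fun b => coefMap D (outer b b) (α, i, j)), ← Fin.sum_univ_fun_getElem]
    rfl
  rw [hl, h1, Matrix.sum_apply]
  simp only [Matrix.mul_apply, Matrix.conjTranspose_apply]
  rw [Finset.sum_comm]
  refine Finset.sum_congr rfl fun k _ => ?_
  rw [coefMap_outer_apply (S := hfinP.toFinset.image fun β => c⁻¹ * β)
    fun x hx hxD => Finset.mem_image.2 ⟨c * x.1, hfinP.mem_toFinset.2 (hsupp k x hx hxD),
      inv_mul_cancel_left _ _⟩,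
    Finset.sum_image fun β _ γ _ h => mul_left_cancel h]
  simp only [B, Matrix.of_apply, mul_assoc]
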